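/- arXiv:math/0405234 — 5 statements merged into one kernel-verified Lean document; each statement's English description precedes it below -/
import Mathlib

section
/- Let w : R → R be a k-algebra homomorphism with w(I) ⊆ I such that the induced map R/I → R/I is the identity and the induced k-linear map I/I² → I/I² is surjective. Then w is bijective, i.e. w is a k-algebra automorphism of R. -/
theorem Submodule.pow_succ_antitone_of_mul_le {k R : Type*} [CommSemiring k] [Semiring R]
    [Algebra k R] {J : Submodule k R} (hJ : J * J ≤ J) :
    Antitone fun n : ℕ => J ^ (n + 1) := by
  refine antitone_nat_of_succ_le fun n => ?_
  rw [pow_succ, pow_succ, mul_assoc]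
  exact mul_le_mul' le_rfl hJ

theorem AlgHom.map_mem_pow {k R : Type*} [CommSemiring k] [Semiring R] [Algebra k R]
    {J : Submodule k R} (w : R →ₐ[k] R) (hw : ∀ x ∈ J, w x ∈ J) (n : ℕ) {x : R}
    (hx : x ∈ J ^ n) : w x ∈ J ^ n := by
  have h : (J ^ n).map w.toLinearMap ≤ J ^ n := by
    rw [Submodule.map_pow]
    exact pow_le_pow_left' (Submodule.map_le_iff_le_comap.2 hw) n
  exact h (Submodule.mem_map_of_mem hx)

/-- Surjectivity of an endomorphism on `J / J ^ 2` propagates to the higher graded pieces. -/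
theorem AlgHom.exists_sub_mem_pow_succ {k R : Type*} [CommRing k] [Ring R] [Algebra k R]
    {J : Submodule k R} (w : R →ₐ[k] R) (hw : ∀ x ∈ J, w x ∈ J)
    (h : ∀ x ∈ J, ∃ y ∈ J, x - w y ∈ J ^ 2) (n : ℕ) :
    ∀ x ∈ J ^ (n + 1), ∃ y ∈ J ^ (n + 1), x - w y ∈ J ^ (n + 2) := by
  induction n with
  | zero => simpa using h
  | succ n ih =>
    intro x hx
    rw [pow_succ] at hx
    induction hx using Submodule.mul_induction_on' with
    | mem_mul_mem a ha b hb =>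
      obtain ⟨a', ha', haa⟩ := ih a ha
      obtain ⟨b', hb', hbb⟩ := h b hb
      refine ⟨a' * b', pow_succ J (n + 1) ▸ Submodule.mul_mem_mul ha' hb', ?_⟩
      have e : a * b - w (a' * b') = (a - w a') * b + w a' * (b - w b') := by
        rw [map_mul]; noncomm_ring
      rw [e]
      refine add_mem ?_ ?_
      · exact pow_succ J (n + 2) ▸ Submodule.mul_mem_mul haa hb
      · have := Submodule.mul_mem_mul (w.map_mem_pow hw _ ha') hbb
        rwa [← pow_add] at this
    | add x _ y _ hx hy =>
      obtain ⟨x', hx', hxx⟩ := hx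
      obtain ⟨y', hy', hyy⟩ := hy
      refine ⟨x' + y', add_mem hx' hy', ?_⟩
      rw [map_add, add_sub_add_comm]
      exact add_mem hxx hyy

/-- A surjective endomorphism of a finite-dimensional subquotient `M / N` is injective. -/
theorem LinearMap.mem_of_map_mem_of_surjective_subquotient {k V : Type*} [Field k]
    [AddCommGroup V] [Module k V] {M N : Submodule k V}
    [FiniteDimensional k (↥M ⧸ N.comap M.subtype)] (f : V →ₗ[k] V)
    (hM : ∀ x ∈ M, f x ∈ M) (hN : ∀ x ∈ N, f x ∈ N)
    (hsurj : ∀ x ∈ M, ∃ y ∈ M, x - f y ∈ N) {x : V} (hx : x ∈ M) (hfx : f x ∈ N) :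
    x ∈ N := by
  let g := (N.comap M.subtype).mapQ (N.comap M.subtype) (f.restrict hM) fun y hy => hN _ hy
  have hg : Function.Surjective g := by
    intro q
    obtain ⟨⟨z, hz⟩, rfl⟩ := Submodule.Quotient.mk_surjective _ q
    obtain ⟨y, hy, hzy⟩ := hsurj z hz
    refine ⟨Submodule.Quotient.mk ⟨y, hy⟩, ?_⟩
    exact ((Submodule.Quotient.eq (N.comap M.subtype)).2 hzy).symm
  have hinj : Function.Injective g := LinearMap.injective_iff_surjective.2 hg
  have h0 : (Submodule.Quotient.mk ⟨x, hx⟩ : ↥M ⧸ N.comap M.subtype) = 0 := by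
    refine hinj ?_
    rw [map_zero]
    exact (Submodule.Quotient.mk_eq_zero (N.comap M.subtype)).2 hfx
  exact (Submodule.Quotient.mk_eq_zero (N.comap M.subtype)).1 h0


/-- Let `k` be a field, `R` an associative unital `k`-algebra and `J` a
two-sided ideal (a `k`-submodule closed under left and right multiplication, so that its
powers make sense) such that `R` is separated and complete in the `J`-adic topology and
`Jⁿ/Jⁿ⁺¹` is finite-dimensional over `k` for every `n ≥ 1`.  If `w : R → R` is a
`k`-algebra homomorphism with `w(J) ⊆ J`, inducing the identity on `R/J` and a surjection
on `J/J²`, then `w` is bijective, i.e. an automorphism of `R`. -/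
theorem stmt_4 {k : Type*} [Field k] {R : Type*} [Ring R] [Algebra k R]
    (J : Submodule k R)
    (htwosided : ∀ r : R, ∀ x ∈ J, r * x ∈ J ∧ x * r ∈ J)
    (hsep : ∀ x : R, (∀ n : ℕ, x ∈ J ^ (n + 1)) → x = 0)
    (hcomp : ∀ s : ℕ → R, (∀ m n : ℕ, n ≤ m → s m - s n ∈ J ^ (n + 1)) →
      ∃ x : R, ∀ n : ℕ, x - s n ∈ J ^ (n + 1))
    (hfd : ∀ n : ℕ, FiniteDimensional k
      (↥(J ^ (n + 1)) ⧸ Submodule.comap (J ^ (n + 1)).subtype (J ^ (n + 2))))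
    (w : R →ₐ[k] R)
    (hwJ : ∀ x ∈ J, w x ∈ J)
    (hRmodJ : ∀ x : R, w x - x ∈ J)
    (hJmodJsq : ∀ x ∈ J, ∃ y ∈ J, x - w y ∈ J ^ 2) :
    Function.Bijective w := by
  have hanti := Submodule.pow_succ_antitone_of_mul_le
    (Submodule.mul_le.2 fun a _ b hb => (htwosided a b hb).1 : J * J ≤ J)
  have hgr := w.exists_sub_mem_pow_succ hwJ hJmodJsq
  constructor
  · refine (injective_iff_map_eq_zero w).2 fun x hx => hsep x fun n => ?_
    induction n with
    | zero => simpa [hx] using hRmodJ x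
    | succ n ih =>
      have := hfd n
      exact w.toLinearMap.mem_of_map_mem_of_surjective_subquotient
        (fun _ => w.map_mem_pow hwJ _) (fun _ => w.map_mem_pow hwJ _) (hgr n) ih
        (by simp [hx])
  · intro x
    choose! u hu hxu using hgr
    let s : ℕ → R := fun n => Nat.rec x (fun n y => y + u n (x - w y)) n
    have hs (n : ℕ) : s (n + 1) = s n + u n (x - w (s n)) := rfl
    have happrox (n : ℕ) : x - w (s n) ∈ J ^ (n + 1) := by
      induction n with
      | zero => simpa [s] using neg_mem (hRmodJ x)
      | succ n ih =>
        rw [hs, map_add, ← sub_sub]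
        exact hxu n _ ih
    have hcauchy (m n : ℕ) (hnm : n ≤ m) : s m - s n ∈ J ^ (n + 1) := by
      induction m, hnm using Nat.le_induction with
      | base => simp
      | succ m hnm ih =>
        rw [hs, add_sub_right_comm]
        exact add_mem ih (hanti hnm (hu m _ (happrox m)))
    obtain ⟨y, hy⟩ := hcomp s hcauchy
    refine ⟨y, (sub_eq_zero.1 (hsep _ fun n => ?_)).symm⟩
    have e : x - w y = (x - w (s n)) - w (y - s n) := by
      rw [map_sub]; abel
    rw [e]
    exact sub_mem (happrox n) (w.map_mem_pow hwJ _ (hy n))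
end

section
/- The A-module Der_k(A) of k-linear derivations A → A is free of rank 1 with basis {∂}; that is, every k-linear derivation of A is of the form h·∂ for a unique h ∈ A. -/
open MvPolynomial

set_option synthInstance.maxHeartbeats 1000000

/-- The polynomial `y² − x³ − ax − b` in `k[x,y]` (with `x = X 0`, `y = X 1`). -/
noncomputable def ellPoly {k : Type*} [CommRing k] (a b : k) : MvPolynomial (Fin 2) k :=
  X 1 ^ 2 - X 0 ^ 3 - C a * X 0 - C b

/-- The affine coordinate ring `A = k[x,y]/(y² − x³ − ax − b)`. -/
abbrev EllRing (k : Type*) [CommRing k] (a b : k) : Type _ :=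
  MvPolynomial (Fin 2) k ⧸ Ideal.span {ellPoly a b}

/-- The class of `x` in `A`. -/
noncomputable def ellX {k : Type*} [CommRing k] (a b : k) : EllRing k a b :=
  Ideal.Quotient.mk _ (X 0)

/-- The class of `y` in `A`. -/
noncomputable def ellY {k : Type*} [CommRing k] (a b : k) : EllRing k a b :=
  Ideal.Quotient.mk _ (X 1)

/-- If `(P, Q)` is unimodular, any `(p, q)` with `P * q = Q * p` is a unique multiple of it. -/
theorem existsUnique_smul_of_unimodular {R : Type*} [CommRing R] {P Q u v p q : R}
    (huv : u * P + v * Q = 1) (hpq : P * q = Q * p) :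
    ∃! h : R, p = h * P ∧ q = h * Q := by
  refine ⟨u * p + v * q, ⟨?_, ?_⟩, ?_⟩
  · linear_combination (-p) * huv - v * hpq
  · linear_combination (-q) * huv + u * hpq
  · rintro h ⟨rfl, rfl⟩
    linear_combination (-h) * huv

/-- The Weierstrass equation in the coordinate ring. -/
theorem ellY_sq {k : Type*} [CommRing k] (a b : k) :
    ellY a b ^ 2 = ellX a b ^ 3 + algebraMap k (EllRing k a b) a * ellX a b
      + algebraMap k (EllRing k a b) b := by
  have h : Ideal.Quotient.mk (Ideal.span {ellPoly a b}) (ellPoly a b) = 0 :=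
    Ideal.Quotient.eq_zero_iff_mem.mpr (Ideal.mem_span_singleton_self _)
  change ellY a b ^ 2 - ellX a b ^ 3 - algebraMap k (EllRing k a b) a * ellX a b
      - algebraMap k (EllRing k a b) b = 0 at h
  linear_combination h

/-- A derivation of the coordinate ring is determined by its values on `x` and `y`. -/
theorem ellRing_derivation_ext {k : Type*} [CommRing k] {a b : k}
    {D E : Derivation k (EllRing k a b) (EllRing k a b)}
    (hx : D (ellX a b) = E (ellX a b)) (hy : D (ellY a b) = E (ellY a b)) : D = E := by
  have h : D.compAlgebraMap (MvPolynomial (Fin 2) k) =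
      E.compAlgebraMap (MvPolynomial (Fin 2) k) := by
    refine MvPolynomial.derivation_ext fun i => ?_
    fin_cases i
    · exact hx
    · exact hy
  ext z
  obtain ⟨p, rfl⟩ := Ideal.Quotient.mk_surjective z
  exact DFunLike.congr_fun h p

/-- The relation between `D x` and `D y` obtained by differentiating the Weierstrass equation. -/
theorem ellRing_derivation_relation {k : Type*} [CommRing k] {a b : k}
    (D : Derivation k (EllRing k a b) (EllRing k a b)) :
    2 * ellY a b * D (ellY a b) =
      (3 * ellX a b ^ 2 + algebraMap k (EllRing k a b) a) * D (ellX a b) := by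
  have h := congrArg D (ellY_sq a b)
  simp only [map_add, Derivation.leibniz, Derivation.leibniz_pow, Derivation.map_algebraMap,
    smul_eq_mul, nsmul_eq_mul] at h
  push_cast at h
  linear_combination h

/-- For nonzero discriminant, the partial derivatives of the Weierstrass equation generate the
unit ideal of the coordinate ring. -/
theorem ellRing_exists_bezout {k : Type*} [Field k] [NeZero (2 : k)] {a b : k}
    (hΔ : 4 * a ^ 3 + 27 * b ^ 2 ≠ 0) :
    ∃ u v : EllRing k a b, u * (-2 * ellY a b) +
      v * -(3 * ellX a b ^ 2 + algebraMap k (EllRing k a b) a) = 1 := by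
  have hΔ' : algebraMap k (EllRing k a b) (4 * a ^ 3 + 27 * b ^ 2)⁻¹ *
      (4 * algebraMap k (EllRing k a b) a ^ 3 + 27 * algebraMap k (EllRing k a b) b ^ 2) = 1 := by
    have h := congrArg (algebraMap k (EllRing k a b)) (inv_mul_cancel₀ hΔ)
    simpa only [map_mul, map_add, map_pow, map_ofNat, map_one] using h
  have h2 : algebraMap k (EllRing k a b) 2⁻¹ * 2 = 1 := by
    have h := congrArg (algebraMap k (EllRing k a b)) (inv_mul_cancel₀ (two_ne_zero (α := k)))
    simpa only [map_mul, map_ofNat, map_one] using h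
  have hy := ellY_sq a b
  generalize algebraMap k (EllRing k a b) (4 * a ^ 3 + 27 * b ^ 2)⁻¹ = c at *
  generalize algebraMap k (EllRing k a b) 2⁻¹ = e at *
  generalize algebraMap k (EllRing k a b) a = α at *
  generalize algebraMap k (EllRing k a b) b = β at *
  generalize ellX a b = x at *
  generalize ellY a b = y at *
  refine ⟨c * e * (18 * α * x - 27 * β) * y, -(c * (6 * α * x ^ 2 - 9 * β * x + 4 * α ^ 2)), ?_⟩
  linear_combination hΔ' - c * (18 * α * x - 27 * β) * y ^ 2 * h2 - c * (18 * α * x - 27 * β) * hy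


/-- Let `k` be algebraically closed of characteristic `0`, `Δ = 4a³+27b² ≠ 0`,
`A = k[x,y]/(y² − x³ − ax − b)` and `d` the `k`-linear derivation of `A` with `∂x = −2y`,
`∂y = −(3x² + a)`.  Then `Der_k(A)` is a free `A`-module of rank 1 with basis `{∂}`: every
`k`-linear derivation `D : A → A` is `h • d` for a unique `h ∈ A`. -/
theorem stmt_9 {k : Type*} [Field k] [IsAlgClosed k] [CharZero k]
    (a b : k) (hΔ : 4 * a ^ 3 + 27 * b ^ 2 ≠ 0)
    (d : Derivation k (EllRing k a b) (EllRing k a b))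
    (hdx : d (ellX a b) = -2 * ellY a b)
    (hdy : d (ellY a b) = -(3 * ellX a b ^ 2 + algebraMap k (EllRing k a b) a)) :
    ∀ D : Derivation k (EllRing k a b) (EllRing k a b),
      ∃! h : EllRing k a b, D = h • d := by
  intro D
  obtain ⟨u, v, huv⟩ := ellRing_exists_bezout hΔ
  have hpq : -2 * ellY a b * D (ellY a b) =
      -(3 * ellX a b ^ 2 + algebraMap k (EllRing k a b) a) * D (ellX a b) := by
    linear_combination -ellRing_derivation_relation D
  refine (existsUnique_congr fun h => ⟨?_, ?_⟩).mp (existsUnique_smul_of_unimodular huv hpq)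
  · rintro ⟨hx, hy⟩
    apply ellRing_derivation_ext
    · rw [Derivation.smul_apply, hdx, smul_eq_mul, hx]
    · rw [Derivation.smul_apply, hdy, smul_eq_mul, hy]
  · rintro rfl
    rw [Derivation.smul_apply, Derivation.smul_apply, hdx, hdy, smul_eq_mul, smul_eq_mul]
    exact ⟨rfl, rfl⟩
end

section
/- The A₁-module Der_k(A₁) of k-linear derivations A₁ → A₁ is free of rank 1 with basis {∂₁}; that is, every k-linear derivation of A₁ is of the form h·∂₁ for a unique h ∈ A₁. -/
open MvPolynomial

set_option synthInstance.maxHeartbeats 1000000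

/-- The polynomial `z − x³ − axz² − bz³` in `k[x,z]` (with `x = X 0`, `z = X 1`). -/
noncomputable def ellPoly₁ {k : Type*} [CommRing k] (a b : k) : MvPolynomial (Fin 2) k :=
  X 1 - X 0 ^ 3 - C a * X 0 * X 1 ^ 2 - C b * X 1 ^ 3

/-- The affine coordinate ring `A₁ = k[x,z]/(z − x³ − axz² − bz³)`. -/
abbrev EllRing₁ (k : Type*) [CommRing k] (a b : k) : Type _ :=
  MvPolynomial (Fin 2) k ⧸ Ideal.span {ellPoly₁ a b}

/-- The class of `x` in `A₁`. -/
noncomputable def ellX₁ {k : Type*} [CommRing k] (a b : k) : EllRing₁ k a b :=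
  Ideal.Quotient.mk _ (X 0)

/-- The class of `z` in `A₁`. -/
noncomputable def ellZ₁ {k : Type*} [CommRing k] (a b : k) : EllRing₁ k a b :=
  Ideal.Quotient.mk _ (X 1)

/-- The defining equation of the curve, in `A₁`. -/
theorem ellZ₁_eq {k : Type*} [CommRing k] (a b : k) :
    ellZ₁ a b = ellX₁ a b ^ 3 + algebraMap k (EllRing₁ k a b) a * ellX₁ a b * ellZ₁ a b ^ 2
      + algebraMap k (EllRing₁ k a b) b * ellZ₁ a b ^ 3 := by
  have h : Ideal.Quotient.mk (Ideal.span {ellPoly₁ a b})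
      (X 1 - X 0 ^ 3 - C a * X 0 * X 1 ^ 2 - C b * X 1 ^ 3) = 0 :=
    Ideal.Quotient.eq_zero_iff_mem.mpr (Ideal.mem_span_singleton_self _)
  have hC (c : k) : Ideal.Quotient.mk (Ideal.span {ellPoly₁ a b}) (C c)
      = algebraMap k (EllRing₁ k a b) c := rfl
  simp only [map_sub, map_mul, map_pow, hC] at h
  rw [ellX₁, ellZ₁]
  linear_combination h

/-- A derivation of `A₁` is determined by its values on `x` and `z`. -/
theorem EllRing₁.derivation_ext {k : Type*} [CommRing k] {a b : k}
    {D E : Derivation k (EllRing₁ k a b) (EllRing₁ k a b)}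
    (hx : D (ellX₁ a b) = E (ellX₁ a b)) (hz : D (ellZ₁ a b) = E (ellZ₁ a b)) : D = E := by
  ext f
  obtain ⟨p, rfl⟩ := Ideal.Quotient.mk_surjective f
  induction p using MvPolynomial.induction_on with
  | C c => exact (D.map_algebraMap c).trans (E.map_algebraMap c).symm
  | add p q hp hq => rw [map_add, map_add, map_add, hp, hq]
  | mul_X p i hp =>
    rw [map_mul, D.leibniz, E.leibniz, hp]
    fin_cases i
    · exact congrArg (fun t => _ • t + _) hx
    · exact congrArg (fun t => _ • t + _) hz

/-- The relation between `D x` and `D z` obtained by differentiating the defining equation. -/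
theorem EllRing₁.derivation_relation {k : Type*} [CommRing k] {a b : k}
    (D : Derivation k (EllRing₁ k a b) (EllRing₁ k a b)) :
    (1 - 2 * algebraMap k (EllRing₁ k a b) a * ellX₁ a b * ellZ₁ a b
      - 3 * algebraMap k (EllRing₁ k a b) b * ellZ₁ a b ^ 2) * D (ellZ₁ a b)
    = (3 * ellX₁ a b ^ 2 + algebraMap k (EllRing₁ k a b) a * ellZ₁ a b ^ 2) * D (ellX₁ a b) := by
  have h := congrArg D (ellZ₁_eq a b)
  simp only [map_add, Derivation.leibniz, Derivation.leibniz_pow, Derivation.map_algebraMap,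
    smul_eq_mul, nsmul_eq_mul, Nat.cast_ofNat, Nat.add_one_sub_one, mul_zero] at h
  linear_combination h

/-- The two partial derivatives of the defining equation generate the unit ideal of `A₁` when
`2` is invertible. -/
theorem EllRing₁.isCoprime_partials {k : Type*} [Field k] [NeZero (2 : k)] (a b : k) :
    IsCoprime (1 - 2 * algebraMap k (EllRing₁ k a b) a * ellX₁ a b * ellZ₁ a b
      - 3 * algebraMap k (EllRing₁ k a b) b * ellZ₁ a b ^ 2)
    (3 * ellX₁ a b ^ 2 + algebraMap k (EllRing₁ k a b) a * ellZ₁ a b ^ 2) := by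
  have hc : 2 * algebraMap k (EllRing₁ k a b) 2⁻¹ = 1 := by
    rw [← map_ofNat (algebraMap k (EllRing₁ k a b)) 2, ← map_mul,
      mul_inv_cancel₀ (NeZero.ne (2 : k)), map_one]
  have hF := ellZ₁_eq a b
  generalize ellX₁ a b = x at *
  generalize ellZ₁ a b = z at *
  generalize algebraMap k (EllRing₁ k a b) 2⁻¹ = c at *
  generalize algebraMap k (EllRing₁ k a b) a = A at *
  generalize algebraMap k (EllRing₁ k a b) b = B at *
  refine ⟨1 - c * z * (2 * A * x + 3 * B * z), c * x * (2 * A * x + 3 * B * z), ?_⟩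
  linear_combination z * (2 * A * x + 3 * B * z) * hc - 3 * c * (2 * A * x + 3 * B * z) * hF

/-- Let `k` be algebraically closed of characteristic `0`, `Δ = 4a³+27b² ≠ 0`,
`A₁ = k[x,z]/(z − x³ − axz² − bz³)` and `∂₁` the `k`-linear derivation of `A₁` with
`∂₁x = 1 − 2axz − 3bz²`, `∂₁z = 3x² + az²`.  Then `Der_k(A₁)` is a free `A₁`-module of
rank 1 with basis `{∂₁}`: every `k`-linear derivation `D : A₁ → A₁` is `h • ∂₁` for a
unique `h ∈ A₁`. -/
theorem stmt_10 {k : Type*} [Field k] [IsAlgClosed k] [CharZero k]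
    (a b : k) (hΔ : 4 * a ^ 3 + 27 * b ^ 2 ≠ 0)
    (d₁ : Derivation k (EllRing₁ k a b) (EllRing₁ k a b))
    (hdx : d₁ (ellX₁ a b) = 1 - 2 * algebraMap k (EllRing₁ k a b) a * ellX₁ a b * ellZ₁ a b
      - 3 * algebraMap k (EllRing₁ k a b) b * ellZ₁ a b ^ 2)
    (hdz : d₁ (ellZ₁ a b) = 3 * ellX₁ a b ^ 2 + algebraMap k (EllRing₁ k a b) a * ellZ₁ a b ^ 2) :
    ∀ D : Derivation k (EllRing₁ k a b) (EllRing₁ k a b),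
      ∃! h : EllRing₁ k a b, D = h • d₁ := by
  intro D
  obtain ⟨α, β, hαβ⟩ := EllRing₁.isCoprime_partials a b
  have hD := EllRing₁.derivation_relation D
  rw [← hdx, ← hdz] at hD hαβ
  refine ⟨α * D (ellX₁ a b) + β * D (ellZ₁ a b), EllRing₁.derivation_ext ?_ ?_, ?_⟩
  · rw [Derivation.smul_apply, smul_eq_mul]
    linear_combination -D (ellX₁ a b) * hαβ - β * hD
  · rw [Derivation.smul_apply, smul_eq_mul]
    linear_combination -D (ellZ₁ a b) * hαβ + α * hD
  · rintro h rfl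
    simp only [Derivation.smul_apply, smul_eq_mul]
    linear_combination -h * hαβ
end

section
/- Assume a ≠ 0. Then 15y² − (4a³ + 27b²)·y⁻² lies in the image ∂₃(A₃) of ∂₃; equivalently, the residue classes of 15y² and of Δ·y⁻² in the cokernel A₃/∂₃(A₃) coincide, where Δ = 4a³ + 27b². -/
open MvPolynomial

set_option synthInstance.maxHeartbeats 1000000

/-- Let `k` be algebraically closed of characteristic `0`,
`Δ = 4a³+27b² ≠ 0`, `a ≠ 0`, `A = k[x,y]/(y² − x³ − ax − b)`, `∂` the `k`-linear
derivation of `A` with `∂x = −2y`, `∂y = −(3x² + a)`, `A₃ = A[y⁻¹]` the localization of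
`A` at `y`, and `∂₃` the unique `k`-linear derivation of `A₃` extending `∂`.  Then
`15y² − Δ·y⁻²` lies in the image `∂₃(A₃)`; equivalently, the residue classes of `15y²`
and of `Δ·y⁻²` in the cokernel `A₃/∂₃(A₃)` coincide. -/
theorem stmt_17 {k : Type*} [Field k] [IsAlgClosed k] [CharZero k]
    (a b : k) (hΔ : 4 * a ^ 3 + 27 * b ^ 2 ≠ 0) (ha : a ≠ 0)
    (d : Derivation k (EllRing k a b) (EllRing k a b))
    (hdx : d (ellX a b) = -2 * ellY a b)
    (hdy : d (ellY a b) = -(3 * ellX a b ^ 2 + algebraMap k (EllRing k a b) a))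
    (A₃ : Type*) [CommRing A₃] [Algebra k A₃] [Algebra (EllRing k a b) A₃]
    [IsScalarTower k (EllRing k a b) A₃]
    [IsLocalization.Away (ellY a b) A₃]
    (d₃ : Derivation k A₃ A₃)
    (hd₃ : ∀ r : EllRing k a b,
      d₃ (algebraMap (EllRing k a b) A₃ r) = algebraMap (EllRing k a b) A₃ (d r))
    (yi : A₃) (hyi : yi * algebraMap (EllRing k a b) A₃ (ellY a b) = 1) :
    15 * algebraMap (EllRing k a b) A₃ (ellY a b) ^ 2
        - algebraMap k A₃ (4 * a ^ 3 + 27 * b ^ 2) * yi ^ 2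
      ∈ LinearMap.range d₃.toLinearMap ∧
    (Submodule.Quotient.mk (15 * algebraMap (EllRing k a b) A₃ (ellY a b) ^ 2) :
        A₃ ⧸ LinearMap.range d₃.toLinearMap) =
      Submodule.Quotient.mk (algebraMap k A₃ (4 * a ^ 3 + 27 * b ^ 2) * yi ^ 2) := by
  have hrel : ellY a b ^ 2 = ellX a b ^ 3 + algebraMap k (EllRing k a b) a * ellX a b
      + algebraMap k (EllRing k a b) b := by
    have h : ellY a b ^ 2 - ellX a b ^ 3 - algebraMap k (EllRing k a b) a * ellX a b
        - algebraMap k (EllRing k a b) b = 0 :=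
      Ideal.Quotient.eq_zero_iff_mem.2 (Ideal.subset_span (Set.mem_singleton (ellPoly a b)))
    rw [sub_sub, sub_sub, sub_eq_zero] at h
    rw [h, add_assoc]
  have hX := hd₃ (ellX a b)
  have hY := hd₃ (ellY a b)
  rw [hdx] at hX
  rw [hdy] at hY
  have hrel' := congrArg (algebraMap (EllRing k a b) A₃) hrel
  simp only [map_add, map_mul, map_neg, map_pow, map_ofNat,
    ← IsScalarTower.algebraMap_apply k (EllRing k a b) A₃] at hX hY hrel'
  generalize algebraMap (EllRing k a b) A₃ (ellX a b) = x at *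
  generalize algebraMap (EllRing k a b) A₃ (ellY a b) = y at *
  have hyi' : d₃ yi = -yi ^ 2 * d₃ y := by
    have h := congrArg d₃ hyi
    rw [Derivation.leibniz, Derivation.map_one_eq_zero, smul_eq_mul, smul_eq_mul] at h
    linear_combination yi * h - d₃ yi * hyi
  have hmem : 15 * y ^ 2 - algebraMap k A₃ (4 * a ^ 3 + 27 * b ^ 2) * yi ^ 2
      ∈ LinearMap.range d₃.toLinearMap := by
    refine ⟨algebraMap k A₃ (-3) * (x * y) + (algebraMap k A₃ (-6 * a) * (x * x)
      + algebraMap k A₃ (9 * b) * x + algebraMap k A₃ (-4 * a ^ 2)) * yi, ?_⟩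
    change d₃ _ = _
    simp only [map_add d₃, Derivation.leibniz, Derivation.map_algebraMap, smul_eq_mul, hyi', hX, hY]
    simp only [map_add, map_mul, map_neg, map_pow, map_ofNat]
    generalize algebraMap k A₃ a = α at *
    generalize algebraMap k A₃ b = β at *
    linear_combination (-9 - (27 * β - 18 * α * x) * yi ^ 2) * hrel'
      + (24 * α * x - 18 * β + (27 * β - 18 * α * x) * (yi * y + 1)) * hyi
  exact ⟨hmem, (Submodule.Quotient.eq _).2 hmem⟩
end

section
/- Assume a = 0 (so b ≠ 0). Then x + 3b·x·y⁻² lies in the image ∂₃(A₃) of ∂₃; equivalently, the residue classes of −3b·xy⁻² and of x in the cokernel A₃/∂₃(A₃) coincide. -/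
open MvPolynomial

set_option synthInstance.maxHeartbeats 1000000

/-- Let `k` be algebraically closed of characteristic `0`,
`Δ = 4a³+27b² ≠ 0`, `a = 0` (so `b ≠ 0`), `A = k[x,y]/(y² − x³ − ax − b)`, `∂` the
`k`-linear derivation of `A` with `∂x = −2y`, `∂y = −(3x² + a)`, `A₃ = A[y⁻¹]` the
localization of `A` at `y`, and `∂₃` the unique `k`-linear derivation of `A₃` extending
`∂`.  Then `x + 3b·x·y⁻²` lies in the image `∂₃(A₃)`; equivalently, the residue classes
of `−3b·xy⁻²` and of `x` in the cokernel `A₃/∂₃(A₃)` coincide. -/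
theorem stmt_18 {k : Type*} [Field k] [IsAlgClosed k] [CharZero k]
    (a b : k) (hΔ : 4 * a ^ 3 + 27 * b ^ 2 ≠ 0) (ha : a = 0)
    (d : Derivation k (EllRing k a b) (EllRing k a b))
    (hdx : d (ellX a b) = -2 * ellY a b)
    (hdy : d (ellY a b) = -(3 * ellX a b ^ 2 + algebraMap k (EllRing k a b) a))
    (A₃ : Type*) [CommRing A₃] [Algebra k A₃] [Algebra (EllRing k a b) A₃]
    [IsScalarTower k (EllRing k a b) A₃]
    [IsLocalization.Away (ellY a b) A₃]
    (d₃ : Derivation k A₃ A₃)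
    (hd₃ : ∀ r : EllRing k a b,
      d₃ (algebraMap (EllRing k a b) A₃ r) = algebraMap (EllRing k a b) A₃ (d r))
    (yi : A₃) (hyi : yi * algebraMap (EllRing k a b) A₃ (ellY a b) = 1) :
    algebraMap (EllRing k a b) A₃ (ellX a b)
        + 3 * algebraMap k A₃ b * algebraMap (EllRing k a b) A₃ (ellX a b) * yi ^ 2
      ∈ LinearMap.range d₃.toLinearMap ∧
    (Submodule.Quotient.mk
        (-(3 * algebraMap k A₃ b) * algebraMap (EllRing k a b) A₃ (ellX a b) * yi ^ 2) :
        A₃ ⧸ LinearMap.range d₃.toLinearMap) =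
      Submodule.Quotient.mk (algebraMap (EllRing k a b) A₃ (ellX a b)) := by
  subst ha
  set X := algebraMap (EllRing k 0 b) A₃ (ellX 0 b) with hX
  set Y := algebraMap (EllRing k 0 b) A₃ (ellY 0 b) with hY
  set B := algebraMap k A₃ b with hB
  have hcurve : Y ^ 2 = X ^ 3 + B := by
    rw [hX, hY, hB, IsScalarTower.algebraMap_apply k (EllRing k 0 b) A₃, ← map_pow, ← map_pow,
      ← map_add, ellY_sq]
    simp
  have hdX : d₃ X = -2 * Y := by rw [hX, hd₃, hdx, map_mul, map_neg, map_ofNat]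
  have hdY : d₃ Y = -(3 * X ^ 2) := by
    rw [hY, hd₃, hdy, map_zero, add_zero, map_neg, map_mul, map_pow, map_ofNat]
  have hdyi : d₃ yi = 3 * X ^ 2 * yi ^ 2 := by
    rw [d₃.leibniz_of_mul_eq_one hyi, hdY, smul_eq_mul]
    ring
  have hmem : X + 3 * B * X * yi ^ 2 ∈ LinearMap.range d₃.toLinearMap := by
    refine ⟨-(X ^ 2 * yi), ?_⟩
    change d₃ (-(X ^ 2 * yi)) = _
    rw [map_neg, Derivation.leibniz, Derivation.leibniz_pow, hdX, hdyi]
    simp only [smul_eq_mul, nsmul_eq_mul]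
    push_cast
    linear_combination (3 * X * yi ^ 2) * hcurve + (4 * X - 3 * X * (yi * Y + 1)) * hyi
  refine ⟨hmem, (Submodule.Quotient.eq _).2 ?_⟩
  convert neg_mem hmem using 1
  ring
end
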